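/- Let U be an orbifold atlas of dimension n on X and let P = [λ_ki, x̃_k, λ_kj] and Q = [λ_li, x̃_l, λ_lj] be two classes in R := R̂/∼ with the same source and target: both pairs of embeddings land in the same charts (Ũ_i, G_i, π_i) and (Ũ_j, G_j, π_j), λ_ki(x̃_k) = λ_li(x̃_l) in Ũ_i and λ_kj(x̃_k) = λ_lj(x̃_l) in Ũ_j. Then there exists a unique g ∈ G_j such that Q = [λ_ki, x̃_k, g ∘ λ_kj]; moreover this g belongs to the stabilizer (G_j)_{λ_kj(x̃_k)} of the point λ_kj(x̃_k) in Ũ_j. -/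

import Mathlib

open Set

noncomputable section

/-- `ℂⁿ`. -/
abbrev CC (n : ℕ) : Type := EuclideanSpace ℂ (Fin n)

/-- A (reduced complex) uniformizing system of dimension `n` for the open set
`U := p '' Ut` of `X`: `Ut ⊆ ℂⁿ` is a nonempty connected open set, `G` is a finite
group of holomorphic automorphisms of `Ut` (encoded as total maps that agree with the
identity outside `Ut`, so that `G` is honestly a set of maps closed under composition
and inversion), and `p` (the map `π`) is continuous, surjective and `G`-invariant on
`Ut`, inducing a homeomorphism `Ut/G ≃ U` (encoded by: the fibres of `p` on `Ut` are
exactly the `G`-orbits and `p` is an open map on `Ut`). -/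
structure UniformizingSystem (n : ℕ) (X : Type*) [TopologicalSpace X] where
  Ut : Set (CC n)
  isOpen_Ut : IsOpen Ut
  isConnected_Ut : IsConnected Ut
  G : Set (CC n → CC n)
  finite_G : G.Finite
  id_mem_G : (id : CC n → CC n) ∈ G
  comp_mem_G : ∀ g ∈ G, ∀ h ∈ G, (g ∘ h) ∈ G
  inv_mem_G : ∀ g ∈ G, ∃ g' ∈ G, (∀ x, g' (g x) = x) ∧ (∀ x, g (g' x) = x)
  mapsTo_G : ∀ g ∈ G, Set.MapsTo g Ut Ut
  eqOn_id_G : ∀ g ∈ G, Set.EqOn g id Utᶜ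
  analytic_G : ∀ g ∈ G, AnalyticOnNhd ℂ g Ut
  p : CC n → X
  continuousOn_p : ContinuousOn p Ut
  isOpen_image_p : IsOpen (p '' Ut)
  invariant_p : ∀ g ∈ G, ∀ x ∈ Ut, p (g x) = p x
  exists_g_of_p_eq : ∀ x ∈ Ut, ∀ y ∈ Ut, p x = p y → ∃ g ∈ G, g x = y
  isOpenMap_p : ∀ V : Set (CC n), V ⊆ Ut → IsOpen V → IsOpen (p '' V)

/-- The underlying open subset of `X` uniformized by the system. -/
def UniformizingSystem.U {n : ℕ} {X : Type*} [TopologicalSpace X]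
    (𝒰 : UniformizingSystem n X) : Set X := 𝒰.p '' 𝒰.Ut

/-- An embedding `l : (Ũ,G,π) → (Ṽ,H,φ)` of uniformizing systems: a holomorphic
embedding (injective, biholomorphism onto its open image) with `φ ∘ l = π` on `Ũ`. -/
structure IsUSEmbedding {n : ℕ} {X : Type*} [TopologicalSpace X]
    (𝒰 𝒱 : UniformizingSystem n X) (l : CC n → CC n) : Prop where
  mapsTo : Set.MapsTo l 𝒰.Ut 𝒱.Ut
  injOn : Set.InjOn l 𝒰.Ut
  analyticOn : AnalyticOnNhd ℂ l 𝒰.Ut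
  isOpen_image : IsOpen (l '' 𝒰.Ut)
  exists_analytic_inv : ∃ m : CC n → CC n,
    AnalyticOnNhd ℂ m (l '' 𝒰.Ut) ∧ ∀ x ∈ 𝒰.Ut, m (l x) = x
  comp_p : ∀ x ∈ 𝒰.Ut, 𝒱.p (l x) = 𝒰.p x

/-- A (reduced complex) orbifold atlas of dimension `n` on `X`: a family of
uniformizing systems whose underlying open sets cover `X`, such that any two charts
are compatible at every point of the intersection of their underlying open sets. -/
structure OrbifoldAtlas (n : ℕ) (X : Type*) [TopologicalSpace X] where
  I : Type
  chart : I → UniformizingSystem n X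
  covers : ∀ x : X, ∃ i : I, x ∈ (chart i).U
  compat : ∀ i j : I, ∀ x ∈ (chart i).U ∩ (chart j).U,
    ∃ k : I, x ∈ (chart k).U ∧ (chart k).U ⊆ (chart i).U ∩ (chart j).U ∧
      (∃ l, IsUSEmbedding (chart k) (chart i) l) ∧
      (∃ l, IsUSEmbedding (chart k) (chart j) l)

/-- An element of the set `R̂` associated to an orbifold atlas `𝒰`: a triple
`(λ_ki, x̃_k, λ_kj)` consisting of a chart `(Ũ_k, G_k, π_k)` of `𝒰`, a point
`x̃_k ∈ Ũ_k`, and two embeddings of this chart into charts of `𝒰`. -/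
structure RHat {n : ℕ} {X : Type*} [TopologicalSpace X] (𝒰 : OrbifoldAtlas n X) where
  k : 𝒰.I
  i : 𝒰.I
  j : 𝒰.I
  x : CC n
  hx : x ∈ (𝒰.chart k).Ut
  li : CC n → CC n
  lj : CC n → CC n
  hli : IsUSEmbedding (𝒰.chart k) (𝒰.chart i) li
  hlj : IsUSEmbedding (𝒰.chart k) (𝒰.chart j) lj

/-- The relation `∼` on `R̂`: two triples (with the same pairs of target charts) are
related iff there are a chart `(Ũ_m, G_m, π_m)`, a point `x̃_m ∈ Ũ_m` and embeddings
`λ_mk, λ_ml` making the two diagrams (of embeddings and of marked points) commute.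
Triples whose targets have different index pairs are declared not related. -/
def RRel {n : ℕ} {X : Type*} [TopologicalSpace X] (𝒰 : OrbifoldAtlas n X)
    (a b : RHat 𝒰) : Prop :=
  a.i = b.i ∧ a.j = b.j ∧
  ∃ (m : 𝒰.I) (xm : CC n) (_ : xm ∈ (𝒰.chart m).Ut) (mk ml : CC n → CC n),
    IsUSEmbedding (𝒰.chart m) (𝒰.chart a.k) mk ∧
    IsUSEmbedding (𝒰.chart m) (𝒰.chart b.k) ml ∧
    (∀ y ∈ (𝒰.chart m).Ut, a.li (mk y) = b.li (ml y)) ∧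
    (∀ y ∈ (𝒰.chart m).Ut, a.lj (mk y) = b.lj (ml y)) ∧
    mk xm = a.x ∧ ml xm = b.x

theorem AnalyticOnNhd.exists_eqOn_of_finite {n : ℕ} {ι : Type*} {M W : Set (CC n)}
    (hM : IsPreconnected M) (hW : IsOpen W) (hWM : W ⊆ M) (hne : W.Nonempty)
    {T : Set ι} (hT : T.Finite) {F : ι → CC n → CC n} {f : CC n → CC n}
    (hF : ∀ s ∈ T, AnalyticOnNhd ℂ (F s) M) (hf : AnalyticOnNhd ℂ f M)
    (h : ∀ x ∈ W, ∃ s ∈ T, F s x = f x) :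
    ∃ s ∈ T, EqOn (F s) f M := by
  by_contra! hcon
  induction T, hT using Set.Finite.induction_on generalizing W with
  | empty =>
    obtain ⟨x, hx⟩ := hne
    obtain ⟨s, hs, -⟩ := h x hx
    exact hs
  | @insert t T _ _ ih =>
    have hcont : ContinuousOn (fun x => F t x - f x) W :=
      (((hF t (mem_insert _ _)).continuousOn).sub hf.continuousOn).mono hWM
    refine ih (W := W ∩ (fun x => F t x - f x) ⁻¹' {0}ᶜ)
      (hcont.isOpen_inter_preimage hW isOpen_compl_singleton)
      (inter_subset_left.trans hWM) ?_ (fun s hs => hF s (mem_insert_of_mem _ hs)) ?_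
      (fun s hs => hcon s (mem_insert_of_mem _ hs))
    · by_contra hempty
      obtain ⟨x, hx⟩ := hne
      refine hcon t (mem_insert _ _) ((hF t (mem_insert _ _)).eqOn_of_preconnected_of_eventuallyEq
        hf hM (hWM hx) ?_)
      filter_upwards [hW.mem_nhds hx] with y hy
      by_contra hne'
      exact hempty ⟨y, hy, by simpa [sub_eq_zero] using hne'⟩
    · rintro x ⟨hxW, hx⟩
      obtain ⟨s, rfl | hs, hsx⟩ := h x hxW
      · exact absurd (by simp [hsx]) hx
      · exact ⟨s, hs, hsx⟩

section

variable {n : ℕ} {X : Type*} [TopologicalSpace X] {𝒰 𝒱 𝒲 : UniformizingSystem n X}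
  {l l' : CC n → CC n}

theorem IsUSEmbedding.isOpen_image_of_subset (h : IsUSEmbedding 𝒰 𝒱 l) {S : Set (CC n)}
    (hS : IsOpen S) (hSU : S ⊆ 𝒰.Ut) : IsOpen (l '' S) := by
  obtain ⟨m, hm, hml⟩ := h.exists_analytic_inv
  suffices himg : l '' S = l '' 𝒰.Ut ∩ m ⁻¹' S from
    himg ▸ hm.continuousOn.isOpen_inter_preimage h.isOpen_image hS
  ext y
  constructor
  · rintro ⟨x, hx, rfl⟩
    exact ⟨⟨x, hSU hx, rfl⟩, by simpa [hml x (hSU hx)] using hx⟩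
  · rintro ⟨⟨x, hx, rfl⟩, hy⟩
    exact ⟨x, by simpa [hml x hx] using hy, rfl⟩

theorem IsUSEmbedding.comp (h' : IsUSEmbedding 𝒱 𝒲 l') (h : IsUSEmbedding 𝒰 𝒱 l) :
    IsUSEmbedding 𝒰 𝒲 (l' ∘ l) where
  mapsTo := h'.mapsTo.comp h.mapsTo
  injOn := h'.injOn.comp h.injOn h.mapsTo
  analyticOn := h'.analyticOn.comp h.analyticOn h.mapsTo
  isOpen_image := by
    rw [image_comp]
    exact h'.isOpen_image_of_subset h.isOpen_image h.mapsTo.image_subset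
  exists_analytic_inv := by
    obtain ⟨m, hm, hml⟩ := h.exists_analytic_inv
    obtain ⟨m', hm', hml'⟩ := h'.exists_analytic_inv
    refine ⟨m ∘ m', hm.comp (hm'.mono ?_) ?_, fun x hx => ?_⟩
    · rintro _ ⟨x, hx, rfl⟩
      exact ⟨l x, h.mapsTo hx, rfl⟩
    · rintro _ ⟨x, hx, rfl⟩
      exact ⟨x, hx, (hml' _ (h.mapsTo hx)).symm⟩
    · simp [hml' _ (h.mapsTo hx), hml x hx]
  comp_p x hx := (h'.comp_p _ (h.mapsTo hx)).trans (h.comp_p x hx)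

theorem UniformizingSystem.isUSEmbedding_of_mem_G {g : CC n → CC n} (hg : g ∈ 𝒰.G) :
    IsUSEmbedding 𝒰 𝒰 g := by
  obtain ⟨g', hg', hl, hr⟩ := 𝒰.inv_mem_G g hg
  have himg : g '' 𝒰.Ut = 𝒰.Ut :=
    (𝒰.mapsTo_G g hg).image_subset.antisymm fun x hx => ⟨g' x, 𝒰.mapsTo_G g' hg' hx, hr x⟩
  exact
    { mapsTo := 𝒰.mapsTo_G g hg
      injOn := (Function.LeftInverse.injective hl).injOn
      analyticOn := 𝒰.analytic_G g hg
      isOpen_image := by rw [himg]; exact 𝒰.isOpen_Ut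
      exists_analytic_inv := ⟨g', himg.symm ▸ 𝒰.analytic_G g' hg', fun x _ => hl x⟩
      comp_p := 𝒰.invariant_p g hg }

/-- Two embeddings of the same uniformizing system differ by an element of the group. -/
theorem IsUSEmbedding.exists_comp_eqOn (h : IsUSEmbedding 𝒰 𝒱 l) (h' : IsUSEmbedding 𝒰 𝒱 l') :
    ∃ g ∈ 𝒱.G, EqOn (g ∘ l) l' 𝒰.Ut :=
  AnalyticOnNhd.exists_eqOn_of_finite (F := fun g => g ∘ l) 𝒰.isConnected_Ut.isPreconnected
    𝒰.isOpen_Ut subset_rfl 𝒰.isConnected_Ut.nonempty 𝒱.finite_G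
    (fun g hg => (𝒱.analytic_G g hg).comp h.analyticOn h.mapsTo) h'.analyticOn
    fun x hx => 𝒱.exists_g_of_p_eq _ (h.mapsTo hx) _ (h'.mapsTo hx)
      ((h.comp_p x hx).trans (h'.comp_p x hx).symm)

/-- An element of the target group moving the image of an embedding to a set that meets this
image is induced by an element of the source group. -/
theorem IsUSEmbedding.exists_mem_G_lift (h : IsUSEmbedding 𝒰 𝒱 l) {g : CC n → CC n}
    (hg : g ∈ 𝒱.G) {x y : CC n} (hx : x ∈ 𝒰.Ut) (hy : y ∈ 𝒰.Ut) (hxy : g (l x) = l y) :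
    ∃ g' ∈ 𝒰.G, EqOn (l ∘ g') (g ∘ l) 𝒰.Ut := by
  have hgl := (UniformizingSystem.isUSEmbedding_of_mem_G hg).comp h
  refine AnalyticOnNhd.exists_eqOn_of_finite (F := fun g' => l ∘ g')
    (W := 𝒰.Ut ∩ (g ∘ l) ⁻¹' (l '' 𝒰.Ut)) 𝒰.isConnected_Ut.isPreconnected
    (hgl.analyticOn.continuousOn.isOpen_inter_preimage 𝒰.isOpen_Ut h.isOpen_image)
    inter_subset_left ⟨x, hx, y, hy, hxy.symm⟩ 𝒰.finite_G
    (fun g' hg' => h.analyticOn.comp (𝒰.analytic_G g' hg') (𝒰.mapsTo_G g' hg'))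
    hgl.analyticOn ?_
  rintro u ⟨hu, v, hv, huv⟩
  obtain ⟨g', hg', hg'u⟩ := 𝒰.exists_g_of_p_eq u hu v hv
    (by rw [← hgl.comp_p u hu, ← huv, h.comp_p v hv])
  exact ⟨g', hg', (congrArg l hg'u).trans huv⟩

/-- An element of the group is determined by its restriction to a nonempty open subset. -/
theorem UniformizingSystem.eq_of_eqOn_open {g g' : CC n → CC n} (hg : g ∈ 𝒰.G) (hg' : g' ∈ 𝒰.G)
    {W : Set (CC n)} (hW : IsOpen W) (hWU : W ⊆ 𝒰.Ut) (hne : W.Nonempty) (h : EqOn g g' W) :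
    g = g' := by
  obtain ⟨x, hx⟩ := hne
  have hU : EqOn g g' 𝒰.Ut :=
    (𝒰.analytic_G g hg).eqOn_of_preconnected_of_eventuallyEq (𝒰.analytic_G g' hg')
      𝒰.isConnected_Ut.isPreconnected (hWU hx) (h.eventuallyEq_of_mem (hW.mem_nhds hx))
  funext y
  by_cases hy : y ∈ 𝒰.Ut
  · exact hU hy
  · rw [𝒰.eqOn_id_G g hg hy, 𝒰.eqOn_id_G g' hg' hy]

theorem OrbifoldAtlas.exists_embeddings_of_p_eq (𝒰 : OrbifoldAtlas n X) {k l : 𝒰.I} {x y : CC n}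
    (hx : x ∈ (𝒰.chart k).Ut) (hy : y ∈ (𝒰.chart l).Ut)
    (hxy : (𝒰.chart k).p x = (𝒰.chart l).p y) :
    ∃ (m : 𝒰.I) (z : CC n) (mk ml : CC n → CC n), z ∈ (𝒰.chart m).Ut ∧
      IsUSEmbedding (𝒰.chart m) (𝒰.chart k) mk ∧ IsUSEmbedding (𝒰.chart m) (𝒰.chart l) ml ∧
      mk z = x ∧ ml z = y := by
  obtain ⟨m, ⟨z, hz, hzx⟩, -, ⟨mk, hmk⟩, ml, hml⟩ :=
    𝒰.compat k l ((𝒰.chart k).p x) ⟨⟨x, hx, rfl⟩, y, hy, hxy.symm⟩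
  obtain ⟨g, hg, hgx⟩ := (𝒰.chart k).exists_g_of_p_eq _ (hmk.mapsTo hz) x hx
    ((hmk.comp_p z hz).trans hzx)
  obtain ⟨g', hg', hgy⟩ := (𝒰.chart l).exists_g_of_p_eq _ (hml.mapsTo hz) y hy
    ((hml.comp_p z hz).trans (hzx.trans hxy))
  exact ⟨m, z, g ∘ mk, g' ∘ ml, hz,
    (UniformizingSystem.isUSEmbedding_of_mem_G hg).comp hmk,
    (UniformizingSystem.isUSEmbedding_of_mem_G hg').comp hml, hgx, hgy⟩

end

/-- If `P = [λ_ki, x̃_k, λ_kj]` and `Q = [λ_li, x̃_l, λ_lj]` have the same source and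
target, there is a unique `g ∈ G_j` with `Q = [λ_ki, x̃_k, g ∘ λ_kj]`; moreover every
such `g` stabilizes the point `λ_kj(x̃_k)`. Here `a` is the representative of `P` and
`b` the representative of `Q`. -/
theorem statement15 {n : ℕ} {X : Type*} [TopologicalSpace X] [T2Space X]
    [SecondCountableTopology X] [ParacompactSpace X]
    (𝒰 : OrbifoldAtlas n X) (a b : RHat 𝒰)
    (hi : a.i = b.i) (hj : a.j = b.j)
    (hs : a.li a.x = b.li b.x) (ht : a.lj a.x = b.lj b.x) :
    (∃! g : CC n → CC n, g ∈ (𝒰.chart a.j).G ∧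
      ∃ h : IsUSEmbedding (𝒰.chart a.k) (𝒰.chart a.j) (g ∘ a.lj),
        RRel 𝒰 b ⟨a.k, a.i, a.j, a.x, a.hx, a.li, g ∘ a.lj, a.hli, h⟩) ∧
    (∀ g ∈ (𝒰.chart a.j).G,
      ∀ h : IsUSEmbedding (𝒰.chart a.k) (𝒰.chart a.j) (g ∘ a.lj),
        RRel 𝒰 b ⟨a.k, a.i, a.j, a.x, a.hx, a.li, g ∘ a.lj, a.hli, h⟩ →
        g (a.lj a.x) = a.lj a.x) := by
  obtain ⟨k, i, j, x, hx, li, lj, hli, hlj⟩ := a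
  obtain ⟨k', i', j', x', hx', li', lj', hli', hlj'⟩ := b
  dsimp only at hi hj hs ht ⊢
  subst hi hj
  refine ⟨?_, ?_⟩
  · refine existsUnique_of_exists_of_unique ?_ ?_
    · obtain ⟨m, z, mk, ml, hz, hmk, hml, hmkz, hmlz⟩ := 𝒰.exists_embeddings_of_p_eq hx hx'
        (by rw [← hli.comp_p x hx, hs, hli'.comp_p x' hx'])
      obtain ⟨g₀, hg₀, hg₀e⟩ := (hli.comp hmk).exists_comp_eqOn (hli'.comp hml)
      have hfix : g₀ (li x) = li x := by
        simpa [hmkz, hmlz, ← hs] using hg₀e hz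
      obtain ⟨h, hh, hhe⟩ := hli.exists_mem_G_lift hg₀ hx hx hfix
      have hhx : h x = x :=
        hli.injOn ((𝒰.chart k).mapsTo_G h hh hx) hx ((hhe hx).trans hfix)
      have hhmk := (UniformizingSystem.isUSEmbedding_of_mem_G hh).comp hmk
      obtain ⟨g, hg, hge⟩ := (hlj.comp hhmk).exists_comp_eqOn (hlj'.comp hml)
      refine ⟨g, hg, (UniformizingSystem.isUSEmbedding_of_mem_G hg).comp hlj, rfl, rfl,
        m, z, hz, ml, h ∘ mk, hml, hhmk, fun y hy => ?_, fun y hy => (hge hy).symm, hmlz, ?_⟩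
      · exact ((hhe (hmk.mapsTo hy)).trans (hg₀e hy)).symm
      · simp [hmkz, hhx]
    · rintro g g' ⟨hg, _, -, -, m, z, hz, mb, ma, hmb, hma, hi, hj, -, hz'⟩
        ⟨hg', _, -, -, m', w, hw, mb', ma', hmb', hma', hi', hj', -, hw'⟩
      have hsub : ma '' (𝒰.chart m).Ut ∩ ma' '' (𝒰.chart m').Ut ⊆ (𝒰.chart k).Ut :=
        inter_subset_left.trans hma.mapsTo.image_subset
      refine UniformizingSystem.eq_of_eqOn_open hg hg'
        (hlj.isOpen_image_of_subset (hma.isOpen_image.inter hma'.isOpen_image) hsub)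
        ((image_mono hsub).trans hlj.mapsTo.image_subset)
        ⟨lj x, x, ⟨⟨z, hz, hz'⟩, w, hw, hw'⟩, rfl⟩ ?_
      rintro _ ⟨_, ⟨⟨u, hu, rfl⟩, v, hv, huv⟩, rfl⟩
      have hb : mb u = mb' v := hli'.injOn (hmb.mapsTo hu) (hmb'.mapsTo hv)
        ((hi u hu).trans ((congrArg li huv).symm.trans (hi' v hv).symm))
      have h₁ : lj' (mb u) = g (lj (ma u)) := hj u hu
      have h₂ : lj' (mb' v) = g' (lj (ma' v)) := hj' v hv
      rw [← h₁, hb, h₂, huv]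
  · rintro g - _ ⟨-, -, m, z, hz, mb, ma, -, -, -, hj, hbz, haz⟩
    dsimp only at hj hbz haz
    have h := hj z hz
    rw [Function.comp_apply, hbz, haz] at h
    rw [← h, ht]
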